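/- (Full high-energy expansion of the coefficient vector q, d=1; formula (4.7), refining Theorem 3.4 for d=1.) For every M ∈ ℕ there exist constants C > 0 and κ₀ > 0 such that for all κ ≥ κ₀ the matrix A(κ) is invertible and for all k ∈ {−κ, κ} and all j ∈ {1,…,n} one has |q_j(k) + Σ_{m=0}^M κ^{−m} Σ_{j'=1}^n [W(κ)^m]_{jj'} α_{j'}^{-1} e^{i k y_{j'}}| ≤ C κ^{−M−1}. In particular q_j(k) = −α_j^{-1} e^{i k y_j} + O(κ^{−1}) as κ → +∞. -/

import Mathlib

open Complex Finset Matrix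

noncomputable section

/-- The matrix `A(κ)` for a one-dimensional multipoint potential:
`A(κ)_{jj} = α_j + 1/(2iκ)`, `A(κ)_{jj'} = e^{iκ|y_j - y_{j'}|}/(2iκ)` for `j ≠ j'`. -/
def A1 (n : ℕ) (y : Fin n → ℝ) (α : Fin n → ℂ) (κ : ℝ) : Matrix (Fin n) (Fin n) ℂ :=
  fun j j' => (if j = j' then α j else 0) +
    Complex.exp (Complex.I * κ * |y j - y j'|) / (2 * Complex.I * κ)

/-- `q(k) = A(κ)⁻¹ b(k)` with `b(k)_j = -e^{i k y_j}`. -/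
def q1 (n : ℕ) (y : Fin n → ℝ) (α : Fin n → ℂ) (κ k : ℝ) : Fin n → ℂ :=
  (A1 n y α κ)⁻¹ *ᵥ fun j => -Complex.exp (Complex.I * k * y j)

/-- The scattering amplitude `f(k,ℓ) = (2π)⁻¹ Σ_j q_j(k) e^{-iℓ y_j}`. -/
def f1 (n : ℕ) (y : Fin n → ℝ) (α : Fin n → ℂ) (κ k ℓ : ℝ) : ℂ :=
  (2 * Real.pi : ℂ)⁻¹ * ∑ j, q1 n y α κ k j * Complex.exp (-Complex.I * ℓ * y j)

/-- The matrix `W(κ)` with `W(κ)_{jj'} = (i/2) α_j⁻¹ e^{iκ|y_j - y_{j'}|}`. -/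
def W1 (n : ℕ) (y : Fin n → ℝ) (α : Fin n → ℂ) (κ : ℝ) : Matrix (Fin n) (Fin n) ℂ :=
  fun j j' => Complex.I / 2 * (α j)⁻¹ * Complex.exp (Complex.I * κ * |y j - y j'|)

/-- The coefficients `C_m(k,ℓ) = Σ_{j,j'} [W(κ)^m]_{jj'} α_{j'}⁻¹ e^{i(k y_{j'} - ℓ y_j)}`. -/
def C1coef (n : ℕ) (y : Fin n → ℝ) (α : Fin n → ℂ) (κ : ℝ) (m : ℕ) (k ℓ : ℝ) : ℂ :=
  ∑ j, ∑ j', (W1 n y α κ ^ m) j j' * (α j')⁻¹ *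
    Complex.exp (Complex.I * (k * y j' - ℓ * y j))

lemma W1_bound (n : ℕ) (y : Fin n → ℝ) (α : Fin n → ℂ) (κ : ℝ) (x : Fin n → ℂ) :
    ‖W1 n y α κ *ᵥ x‖ ≤ (n * ∑ j, ‖(α j)⁻¹‖) * ‖x‖ := by
  have hS : 0 ≤ ∑ j, ‖(α j)⁻¹‖ := Finset.sum_nonneg fun _ _ => norm_nonneg _
  rw [pi_norm_le_iff_of_nonneg (by positivity)]
  intro j
  have hj : ‖(α j)⁻¹‖ ≤ ∑ j, ‖(α j)⁻¹‖ :=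
    Finset.single_le_sum (f := fun j => ‖(α j)⁻¹‖) (fun _ _ => norm_nonneg _) (Finset.mem_univ j)
  have h1 : ∀ j', ‖W1 n y α κ j j' * x j'‖ ≤ (∑ j, ‖(α j)⁻¹‖) * ‖x‖ := by
    intro j'
    have he : ‖Complex.exp (Complex.I * κ * |y j - y j'|)‖ = 1 := by
      have : Complex.I * κ * |y j - y j'| = ((κ * |y j - y j'| : ℝ) : ℂ) * Complex.I := by
        push_cast; ring
      rw [this, Complex.norm_exp_ofReal_mul_I]
    rw [norm_mul]
    refine mul_le_mul ?_ (norm_le_pi_norm x j') (norm_nonneg _) hS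
    unfold W1
    rw [norm_mul, he, norm_mul, mul_one]
    have : ‖Complex.I / 2‖ = 1 / 2 := by simp
    rw [this]
    have := norm_nonneg (α j)⁻¹
    linarith
  calc ‖(W1 n y α κ *ᵥ x) j‖ = ‖∑ j', W1 n y α κ j j' * x j'‖ := rfl
    _ ≤ ∑ j', ‖W1 n y α κ j j' * x j'‖ := norm_sum_le _ _
    _ ≤ ∑ _j' : Fin n, (∑ j, ‖(α j)⁻¹‖) * ‖x‖ := Finset.sum_le_sum fun j' _ => h1 j'
    _ = _ := by simp; ring

lemma W1_pow_bound (n : ℕ) (y : Fin n → ℝ) (α : Fin n → ℂ) (κ : ℝ) (m : ℕ) (x : Fin n → ℂ) :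
    ‖(W1 n y α κ ^ m) *ᵥ x‖ ≤ (n * ∑ j, ‖(α j)⁻¹‖) ^ m * ‖x‖ := by
  have hS : 0 ≤ ∑ j, ‖(α j)⁻¹‖ := Finset.sum_nonneg fun _ _ => norm_nonneg _
  induction m with
  | zero => simp
  | succ m ih =>
    rw [pow_succ', ← Matrix.mulVec_mulVec, pow_succ', mul_assoc]
    exact (W1_bound n y α κ _).trans (mul_le_mul_of_nonneg_left ih (by positivity))

lemma A1_factor (n : ℕ) (y : Fin n → ℝ) (α : Fin n → ℂ) (hα : ∀ j, α j ≠ 0)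
    (κ : ℝ) (hκ : 0 < κ) :
    A1 n y α κ = Matrix.diagonal α * (1 - (κ : ℂ)⁻¹ • W1 n y α κ) := by
  have hk : (κ : ℂ) ≠ 0 := by exact_mod_cast hκ.ne'
  ext j j'
  rw [Matrix.diagonal_mul, Matrix.sub_apply, Matrix.smul_apply, Matrix.one_apply]
  unfold A1 W1
  have hj := hα j
  have hI : (2 * Complex.I * κ)⁻¹ = -(Complex.I / 2 * (κ : ℂ)⁻¹) := by
    rw [mul_inv, mul_inv, Complex.inv_I]; ring
  rw [div_eq_mul_inv, hI, mul_sub, smul_eq_mul]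
  have : α j * ((κ : ℂ)⁻¹ * (Complex.I / 2 * (α j)⁻¹ *
      Complex.exp (Complex.I * κ * |y j - y j'|))) =
      (α j * (α j)⁻¹) * ((κ : ℂ)⁻¹ * (Complex.I / 2 *
      Complex.exp (Complex.I * κ * |y j - y j'|))) := by ring
  rw [this, mul_inv_cancel₀ hj]
  split_ifs <;> ring

lemma main_expansion (n : ℕ) (y : Fin n → ℝ) (α : Fin n → ℂ) (hα : ∀ j, α j ≠ 0) (M : ℕ) :
    ∃ C > (0 : ℝ), ∃ κ₀ > (0 : ℝ), ∀ κ ≥ κ₀, IsUnit (A1 n y α κ) ∧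
      ∀ k : ℝ, ∀ j : Fin n,
        ‖q1 n y α κ k j + ∑ m ∈ Finset.range (M + 1),
            (∑ j' : Fin n, (W1 n y α κ ^ m) j j' * (α j')⁻¹ *
              Complex.exp (Complex.I * k * y j')) / (κ : ℂ) ^ m‖ ≤
          C / κ ^ (M + 1) := by
  set S := ∑ j, ‖(α j)⁻¹‖ with hSdef
  have hS : 0 ≤ S := Finset.sum_nonneg fun _ _ => norm_nonneg _
  set K : ℝ := n * S with hK
  have hK0 : 0 ≤ K := by positivity
  refine ⟨2 * (K ^ (M + 1) * S) + 1, by positivity, 2 * K + 1, by positivity, ?_⟩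
  intro κ hκ
  have hκ0 : 0 < κ := by linarith
  have hk : (κ : ℂ) ≠ 0 := by exact_mod_cast hκ0.ne'
  set W := W1 n y α κ with hW
  set N := (κ : ℂ)⁻¹ • W with hN
  have hpow : ∀ (m : ℕ) x, ‖(N ^ m) *ᵥ x‖ ≤ K ^ m * ‖x‖ / κ ^ m := by
    intro m x
    rw [hN, smul_pow, Matrix.smul_mulVec, norm_smul, norm_pow, norm_inv, Complex.norm_real,
      Real.norm_of_nonneg hκ0.le, div_eq_inv_mul, inv_pow]
    exact mul_le_mul_of_nonneg_left (W1_pow_bound n y α κ m x) (by positivity)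
  have hhalf : ∀ x, ‖N *ᵥ x‖ ≤ 1 / 2 * ‖x‖ := by
    intro x
    have h := hpow 1 x
    simp only [pow_one] at h
    refine h.trans ?_
    rw [div_le_iff₀ hκ0]
    nlinarith [norm_nonneg x]
  have hfac := A1_factor n y α hα κ hκ0
  rw [← hW, ← hN] at hfac
  have hU1 : IsUnit (1 - N) := by
    rw [← Matrix.mulVec_injective_iff_isUnit]
    intro a b hab
    have h0 : N *ᵥ (a - b) = a - b := by
      simp only [Matrix.sub_mulVec, Matrix.one_mulVec] at hab
      rw [Matrix.mulVec_sub]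
      linear_combination (exp := 1) -hab
    have h1 := hhalf (a - b)
    rw [h0] at h1
    have h2 : ‖a - b‖ = 0 := by linarith [norm_nonneg (a - b)]
    exact sub_eq_zero.1 (norm_eq_zero.1 h2)
  have hUD : IsUnit (Matrix.diagonal α) := by
    rw [Matrix.isUnit_iff_isUnit_det, Matrix.det_diagonal, isUnit_iff_ne_zero]
    exact Finset.prod_ne_zero_iff.2 fun j _ => hα j
  have hUA : IsUnit (A1 n y α κ) := by rw [hfac]; exact hUD.mul hU1
  refine ⟨hUA, ?_⟩
  intro k
  set v : Fin n → ℂ := fun j => (α j)⁻¹ * Complex.exp (Complex.I * k * y j) with hv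
  have hvS : ‖v‖ ≤ S := by
    rw [pi_norm_le_iff_of_nonneg hS]
    intro j
    have he : ‖Complex.exp (Complex.I * k * y j)‖ = 1 := by
      have : Complex.I * k * y j = ((k * y j : ℝ) : ℂ) * Complex.I := by
        push_cast; ring
      rw [this, Complex.norm_exp_ofReal_mul_I]
    rw [hv]
    simp only [norm_mul, he, mul_one]
    exact Finset.single_le_sum (f := fun j => ‖(α j)⁻¹‖) (fun _ _ => norm_nonneg _)
      (Finset.mem_univ j)
  set q := q1 n y α κ k with hq
  have hAq : A1 n y α κ *ᵥ q = fun j => -Complex.exp (Complex.I * k * y j) := by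
    rw [hq]
    unfold q1
    rw [Matrix.mulVec_mulVec, Matrix.mul_nonsing_inv _ ((Matrix.isUnit_iff_isUnit_det _).1 hUA),
      Matrix.one_mulVec]
  have hNq : (1 - N) *ᵥ q = -v := by
    rw [hfac, ← Matrix.mulVec_mulVec] at hAq
    ext j
    have h := congrFun hAq j
    rw [Matrix.mulVec_diagonal] at h
    apply mul_left_cancel₀ (hα j)
    rw [h, hv]
    simp only [Pi.neg_apply]
    rw [mul_neg, ← mul_assoc, mul_inv_cancel₀ (hα j), one_mul]
  set r := q + (∑ m ∈ Finset.range (M + 1), N ^ m) *ᵥ v with hr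
  have hNr : (1 - N) *ᵥ r = -((N ^ (M + 1)) *ᵥ v) := by
    rw [hr, Matrix.mulVec_add, hNq, Matrix.mulVec_mulVec, mul_neg_geom_sum, Matrix.sub_mulVec,
      Matrix.one_mulVec]
    abel
  have hrb : ‖r‖ ≤ 2 * (K ^ (M + 1) * S) / κ ^ (M + 1) := by
    have h1 : r = N *ᵥ r - (N ^ (M + 1)) *ᵥ v := by
      rw [Matrix.sub_mulVec, Matrix.one_mulVec] at hNr
      linear_combination (exp := 1) hNr
    have h2 : ‖r‖ ≤ ‖N *ᵥ r‖ + ‖(N ^ (M + 1)) *ᵥ v‖ := by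
      conv_lhs => rw [h1]
      exact norm_sub_le _ _
    have h3 := hhalf r
    have h4 := hpow (M + 1) v
    have h5 : K ^ (M + 1) * ‖v‖ / κ ^ (M + 1) ≤ K ^ (M + 1) * S / κ ^ (M + 1) := by gcongr
    rw [mul_div_assoc]
    linarith
  intro j
  have hrj : q j + ∑ m ∈ Finset.range (M + 1),
            (∑ j' : Fin n, (W ^ m) j j' * (α j')⁻¹ *
              Complex.exp (Complex.I * k * y j')) / (κ : ℂ) ^ m = r j := by
    rw [hr, Pi.add_apply, Matrix.sum_mulVec, Finset.sum_apply]
    congr 1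
    refine Finset.sum_congr rfl fun m _ => ?_
    rw [hN, smul_pow, Matrix.smul_mulVec, Pi.smul_apply, smul_eq_mul, div_eq_inv_mul, inv_pow]
    congr 1
    refine Finset.sum_congr rfl fun j' _ => ?_
    rw [hv, mul_assoc]
  rw [hrj]
  refine (norm_le_pi_norm r j).trans (hrb.trans ?_)
  gcongr
  linarith

/-- Full high-energy expansion of the coefficient vector q, d = 1 (formula (4.7)),
together with its leading-order particular case. -/
theorem stmt6 (n : ℕ) (y : Fin n → ℝ) (α : Fin n → ℂ)
    (hy : Function.Injective y) (hα : ∀ j, α j ≠ 0) :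
    (∀ M : ℕ, ∃ C > (0 : ℝ), ∃ κ₀ > (0 : ℝ), ∀ κ ≥ κ₀, IsUnit (A1 n y α κ) ∧
      ∀ k : ℝ, (k = κ ∨ k = -κ) → ∀ j : Fin n,
        ‖q1 n y α κ k j + ∑ m ∈ Finset.range (M + 1),
            (∑ j' : Fin n, (W1 n y α κ ^ m) j j' * (α j')⁻¹ *
              Complex.exp (Complex.I * k * y j')) / (κ : ℂ) ^ m‖ ≤
          C / κ ^ (M + 1)) ∧
    (∃ C > (0 : ℝ), ∃ κ₀ > (0 : ℝ), ∀ κ ≥ κ₀, IsUnit (A1 n y α κ) ∧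
      ∀ k : ℝ, (k = κ ∨ k = -κ) → ∀ j : Fin n,
        ‖q1 n y α κ k j + (α j)⁻¹ * Complex.exp (Complex.I * k * y j)‖ ≤ C / κ) := by
  refine ⟨fun M => ?_, ?_⟩
  · obtain ⟨C, hC, κ₀, hκ₀, h⟩ := main_expansion n y α hα M
    exact ⟨C, hC, κ₀, hκ₀, fun κ hκ => ⟨(h κ hκ).1, fun k _ j => (h κ hκ).2 k j⟩⟩
  · obtain ⟨C, hC, κ₀, hκ₀, h⟩ := main_expansion n y α hα 0
    refine ⟨C, hC, κ₀, hκ₀, fun κ hκ => ⟨(h κ hκ).1, fun k _ j => ?_⟩⟩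
    have := (h κ hκ).2 k j
    simpa [Matrix.one_apply] using this
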